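/- (Total energy conservation for the continuous Vlasov–Poisson system.) Under the stated hypotheses, the total energy 𝓔(t) = ∫₀¹ ∫_ℝ (v²/2) f(x,v,t) dv dx + ∫₀¹ (1/2) |∂_x Φ(x,t)|² dx is constant in time: 𝓔(t) = 𝓔(0) for all t ∈ [0,T]. -/

import Mathlib

open MeasureTheory intervalIntegral

/-- Differentiation under an interval integral with jointly continuous derivative. -/
lemma hasDerivAt_intervalIntegral_of_continuous {G G' : ℝ → ℝ → ℝ} (a b : ℝ)
    (hG : Continuous fun p : ℝ × ℝ => G p.1 p.2) (hG' : Continuous fun p : ℝ × ℝ => G' p.1 p.2)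
    (hd : ∀ t x, HasDerivAt (fun s => G s x) (G' t x) t) (t₀ : ℝ) :
    HasDerivAt (fun t => ∫ x in a..b, G t x) (∫ x in a..b, G' t₀ x) t₀ := by
  obtain ⟨C, hC⟩ := ((isCompact_Icc (a := t₀ - 1) (b := t₀ + 1)).prod
    (isCompact_uIcc (a := a) (b := b))).exists_bound_of_continuousOn hG'.continuousOn
  have hslice : ∀ t, Continuous (G t) := fun t => hG.comp (by fun_prop : Continuous fun x => (t, x))
  have hslice' : ∀ t, Continuous (G' t) :=
    fun t => hG'.comp (by fun_prop : Continuous fun x => (t, x))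
  refine (intervalIntegral.hasDerivAt_integral_of_dominated_loc_of_deriv_le
    (s := Set.Icc (t₀ - 1) (t₀ + 1)) (bound := fun _ => C) (F' := G')
    (Icc_mem_nhds (by linarith) (by linarith))
    (Filter.Eventually.of_forall fun t => (hslice t).aestronglyMeasurable)
    ((hslice t₀).intervalIntegrable _ _) (hslice' t₀).aestronglyMeasurable
    (Filter.Eventually.of_forall fun x hx t ht => hC (t, x) ⟨ht, Set.uIoc_subset_uIcc hx⟩)
    (by simp) (Filter.Eventually.of_forall fun x _ t _ => hd t x)).2

/-- A continuous function supported in `[a, b]` vanishes outside `(a, b)`. -/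
lemma support_subset_Ioo_of_continuous {g : ℝ → ℝ} {a b : ℝ} (hg : Continuous g)
    (hs : ∀ v, g v ≠ 0 → v ∈ Set.Icc a b) : Function.support g ⊆ Set.Ioo a b := by
  rw [← interior_Icc]
  exact interior_maximal hs hg.isOpen_support

/-- The integral over `ℝ` of `w * g` reduces to `[a, b]` when `g` is supported there. -/
lemma integral_mul_eq_intervalIntegral {g : ℝ → ℝ} (w : ℝ → ℝ) {a b : ℝ} (hg : Continuous g)
    (hs : ∀ v, g v ≠ 0 → v ∈ Set.Icc a b) :
    ∫ v, w v * g v = ∫ v in a..b, w v * g v := by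
  refine (intervalIntegral.integral_eq_integral_of_support_subset ?_).symm
  intro v hv
  exact Set.Ioo_subset_Ioc_self
    (support_subset_Ioo_of_continuous hg hs (right_ne_zero_of_mul hv))

/-- Integrating the Vlasov equation at a fixed point in space and time against a weight `w`. -/
lemma integral_weight_mul_of_vlasov {g gt gx gv w w' : ℝ → ℝ} {a b e : ℝ}
    (hg : ∀ v, HasDerivAt g (gv v) v) (hw : ∀ v, HasDerivAt w (w' v) v) (hw' : Continuous w')
    (hgx : Continuous gx) (hgv : Continuous gv)
    (hs : ∀ v, g v ≠ 0 → v ∈ Set.Icc a b)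
    (hV : ∀ v, gt v + v * gx v - e * gv v = 0) :
    ∫ v in a..b, w v * gt v
      = -(∫ v in a..b, v * w v * gx v) - e * ∫ v in a..b, w' v * g v := by
  have hgc : Continuous g := continuous_iff_continuousAt.2 fun v => (hg v).continuousAt
  have hwc : Continuous w := continuous_iff_continuousAt.2 fun v => (hw v).continuousAt
  have hsub := support_subset_Ioo_of_continuous hgc hs
  have ha : g a = 0 := by
    by_contra h
    exact lt_irrefl _ (hsub h).1
  have hb : g b = 0 := by
    by_contra h
    exact lt_irrefl _ (hsub h).2
  have hparts : ∫ v in a..b, w v * gv v = -∫ v in a..b, w' v * g v := by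
    rw [intervalIntegral.integral_mul_deriv_eq_deriv_mul (fun v _ => hw v) (fun v _ => hg v)
      (hw'.intervalIntegrable _ _) (hgv.intervalIntegrable _ _), ha, hb]
    ring
  have hpt : ∀ v, w v * gt v = -(v * w v * gx v) + e * (w v * gv v) := fun v => by
    linear_combination w v * hV v
  simp_rw [hpt]
  rw [intervalIntegral.integral_add (Continuous.intervalIntegrable (by fun_prop) _ _)
    (Continuous.intervalIntegrable (by fun_prop) _ _), intervalIntegral.integral_neg,
    intervalIntegral.integral_const_mul, hparts]
  ring

/-- The velocity moment of `f` with weight `w` over `[-L, L]`. -/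
noncomputable def velocityMoment (L : ℝ) (w : ℝ → ℝ) (f : ℝ → ℝ → ℝ → ℝ) (x t : ℝ) : ℝ :=
  ∫ v in (-L)..L, w v * f x v t

lemma continuous_velocityMoment (L : ℝ) {w : ℝ → ℝ} {f : ℝ → ℝ → ℝ → ℝ} (hw : Continuous w)
    (hf : Continuous fun p : ℝ × ℝ × ℝ => f p.1 p.2.1 p.2.2) :
    Continuous fun p : ℝ × ℝ => velocityMoment L w f p.1 p.2 := by
  refine intervalIntegral.continuous_parametric_intervalIntegral_of_continuous'
    (f := fun (p : ℝ × ℝ) v => w v * f p.1 v p.2) ?_ _ _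
  exact (hw.comp continuous_snd).mul
    (hf.comp (by fun_prop : Continuous fun q : (ℝ × ℝ) × ℝ => (q.1.1, q.2, q.1.2)))

lemma hasDerivAt_velocityMoment_space (L : ℝ) {w : ℝ → ℝ} {f fx : ℝ → ℝ → ℝ → ℝ}
    (hw : Continuous w) (hf : Continuous fun p : ℝ × ℝ × ℝ => f p.1 p.2.1 p.2.2)
    (hfx : Continuous fun p : ℝ × ℝ × ℝ => fx p.1 p.2.1 p.2.2)
    (hd : ∀ x v t, HasDerivAt (fun y => f y v t) (fx x v t) x) (x t : ℝ) :
    HasDerivAt (fun y => velocityMoment L w f y t) (velocityMoment L w fx x t) x := by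
  have hq : Continuous fun q : ℝ × ℝ => (q.1, q.2, t) := by fun_prop
  exact hasDerivAt_intervalIntegral_of_continuous (G := fun y v => w v * f y v t)
    (G' := fun y v => w v * fx y v t) _ _
    ((hw.comp continuous_snd).mul (hf.comp hq)) ((hw.comp continuous_snd).mul (hfx.comp hq))
    (fun y v => (hd y v t).const_mul _) x

lemma hasDerivAt_velocityMoment_time (L : ℝ) {w : ℝ → ℝ} {f ft : ℝ → ℝ → ℝ → ℝ}
    (hw : Continuous w) (hf : Continuous fun p : ℝ × ℝ × ℝ => f p.1 p.2.1 p.2.2)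
    (hft : Continuous fun p : ℝ × ℝ × ℝ => ft p.1 p.2.1 p.2.2)
    (hd : ∀ x v t, HasDerivAt (fun s => f x v s) (ft x v t) t) (x t : ℝ) :
    HasDerivAt (fun s => velocityMoment L w f x s) (velocityMoment L w ft x t) t := by
  have hq : Continuous fun q : ℝ × ℝ => (x, q.2, q.1) := by fun_prop
  exact hasDerivAt_intervalIntegral_of_continuous (G := fun s v => w v * f x v s)
    (G' := fun s v => w v * ft x v s) _ _
    ((hw.comp continuous_snd).mul (hf.comp hq)) ((hw.comp continuous_snd).mul (hft.comp hq))
    (fun s v => (hd x v s).const_mul _) t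

lemma exists_continuous_partials_of_contDiff_three {f : ℝ → ℝ → ℝ → ℝ}
    (hf : ContDiff ℝ 1 (fun p : ℝ × ℝ × ℝ => f p.1 p.2.1 p.2.2)) :
    ∃ fx fv ft : ℝ → ℝ → ℝ → ℝ,
      (Continuous fun p : ℝ × ℝ × ℝ => fx p.1 p.2.1 p.2.2) ∧
      (Continuous fun p : ℝ × ℝ × ℝ => fv p.1 p.2.1 p.2.2) ∧
      (Continuous fun p : ℝ × ℝ × ℝ => ft p.1 p.2.1 p.2.2) ∧
      (∀ x v t, HasDerivAt (fun y => f y v t) (fx x v t) x) ∧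
      (∀ x v t, HasDerivAt (fun w => f x w t) (fv x v t) v) ∧
      (∀ x v t, HasDerivAt (fun s => f x v s) (ft x v t) t) := by
  set F : ℝ × ℝ × ℝ → ℝ := fun p => f p.1 p.2.1 p.2.2
  have hc : Continuous (fderiv ℝ F) := hf.continuous_fderiv one_ne_zero
  have hd : ∀ p, HasFDerivAt F (fderiv ℝ F p) p := fun p =>
    (hf.differentiable one_ne_zero p).hasFDerivAt
  refine ⟨fun x v t => fderiv ℝ F (x, v, t) (1, 0, 0), fun x v t => fderiv ℝ F (x, v, t) (0, 1, 0),
    fun x v t => fderiv ℝ F (x, v, t) (0, 0, 1), by fun_prop, by fun_prop, by fun_prop,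
    fun x v t => ?_, fun x v t => ?_, fun x v t => ?_⟩
  · exact (hd (x, v, t)).comp_hasDerivAt x
      ((hasDerivAt_id x).prodMk ((hasDerivAt_const x v).prodMk (hasDerivAt_const x t)))
  · exact (hd (x, v, t)).comp_hasDerivAt v
      ((hasDerivAt_const v x).prodMk ((hasDerivAt_id v).prodMk (hasDerivAt_const v t)))
  · exact (hd (x, v, t)).comp_hasDerivAt t
      ((hasDerivAt_const t x).prodMk ((hasDerivAt_const t v).prodMk (hasDerivAt_id t)))

lemma exists_contDiff_partial_fst {n : ℕ} {g : ℝ → ℝ → ℝ}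
    (hg : ContDiff ℝ (n + 1) (fun p : ℝ × ℝ => g p.1 p.2)) :
    ∃ gx : ℝ → ℝ → ℝ, ContDiff ℝ n (fun p : ℝ × ℝ => gx p.1 p.2) ∧
      ∀ x t, HasDerivAt (fun y => g y t) (gx x t) x := by
  set F : ℝ × ℝ → ℝ := fun p => g p.1 p.2
  have hc : ContDiff ℝ n (fderiv ℝ F) := hg.fderiv_right le_rfl
  refine ⟨fun x t => fderiv ℝ F (x, t) (1, 0), hc.clm_apply contDiff_const, fun x t => ?_⟩
  exact ((hg.differentiable (by simp) (x, t)).hasFDerivAt).comp_hasDerivAt x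
    ((hasDerivAt_id x).prodMk (hasDerivAt_const x t))

lemma exists_contDiff_partial_snd {n : ℕ} {g : ℝ → ℝ → ℝ}
    (hg : ContDiff ℝ (n + 1) (fun p : ℝ × ℝ => g p.1 p.2)) :
    ∃ gt : ℝ → ℝ → ℝ, ContDiff ℝ n (fun p : ℝ × ℝ => gt p.1 p.2) ∧
      ∀ x t, HasDerivAt (fun s => g x s) (gt x t) t := by
  set F : ℝ × ℝ → ℝ := fun p => g p.1 p.2
  have hc : ContDiff ℝ n (fderiv ℝ F) := hg.fderiv_right le_rfl
  refine ⟨fun x t => fderiv ℝ F (x, t) (0, 1), hc.clm_apply contDiff_const, fun x t => ?_⟩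
  exact ((hg.differentiable (by simp) (x, t)).hasFDerivAt).comp_hasDerivAt t
    ((hasDerivAt_const t x).prodMk (hasDerivAt_id t))

/-- Total energy conservation for the continuous Vlasov–Poisson system:
`𝓔(t) = ∫₀¹ ∫ (v²/2) f dv dx + ∫₀¹ (1/2)|∂_x Φ|² dx` is constant in time. -/
theorem vlasov_poisson_energy_conservation
    (T L : ℝ) (hT : 0 < T) (hL : 0 < L)
    (f : ℝ → ℝ → ℝ → ℝ) (Φ : ℝ → ℝ → ℝ)
    (hf : ContDiff ℝ 1 (fun p : ℝ × ℝ × ℝ => f p.1 p.2.1 p.2.2))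
    (hfper : ∀ x v t : ℝ, f (x + 1) v t = f x v t)
    (hsupp : ∀ t ∈ Set.Icc (0 : ℝ) T, ∀ x v : ℝ, f x v t ≠ 0 → v ∈ Set.Icc (-L) L)
    (hΦ : ContDiff ℝ 2 (fun p : ℝ × ℝ => Φ p.1 p.2))
    (hΦper : ∀ x t : ℝ, Φ (x + 1) t = Φ x t)
    (hVlasov : ∀ x v : ℝ, ∀ t ∈ Set.Icc (0 : ℝ) T,
      deriv (fun s => f x v s) t + v * deriv (fun y => f y v t) x
        - deriv (fun y => Φ y t) x * deriv (fun w => f x w t) v = 0)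
    (ρ : ℝ → ℝ → ℝ)
    (hρ : ∀ x t : ℝ, ρ x t = ∫ v : ℝ, f x v t)
    (hPoisson : ∀ x : ℝ, ∀ t ∈ Set.Icc (0 : ℝ) T,
      -deriv (fun y => deriv (fun z => Φ z t) y) x = ρ x t - 1)
    (𝓔 : ℝ → ℝ)
    (h𝓔 : ∀ t : ℝ, 𝓔 t =
      (∫ x in (0:ℝ)..1, ∫ v : ℝ, v ^ 2 / 2 * f x v t)
        + ∫ x in (0:ℝ)..1, 1 / 2 * (deriv (fun y => Φ y t) x) ^ 2) :
    ∀ t ∈ Set.Icc (0 : ℝ) T, 𝓔 t = 𝓔 0 := by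
  obtain ⟨fx, fv, ft, hfx, hfv, hft, hdx, hdv, hdt⟩ :=
    exists_continuous_partials_of_contDiff_three hf
  obtain ⟨E, hE, hΦx⟩ := exists_contDiff_partial_fst (n := 1)
    (by simpa [one_add_one_eq_two] using hΦ)
  obtain ⟨Ex, hEx, hdEx⟩ := exists_contDiff_partial_fst (n := 0) (by simpa using hE)
  obtain ⟨Et, hEt, hdEt⟩ := exists_contDiff_partial_snd (n := 0) (by simpa using hE)
  replace hE := hE.continuous
  replace hEx := hEx.continuous
  replace hEt := hEt.continuous
  have hfc := hf.continuous
  simp_rw [fun x t => (hΦx x t).deriv, fun x t => (hdEx x t).deriv] at hVlasov hPoisson h𝓔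
  simp_rw [fun x v t => (hdx x v t).deriv, fun x v t => (hdv x v t).deriv,
    fun x v t => (hdt x v t).deriv] at hVlasov
  have hslice : ∀ {g : ℝ → ℝ → ℝ → ℝ}, (Continuous fun p : ℝ × ℝ × ℝ => g p.1 p.2.1 p.2.2) →
      ∀ x t, Continuous fun v => g x v t := fun hg x t =>
    hg.comp (by fun_prop : Continuous fun v => (x, v, t))
  have hspace : ∀ {g : ℝ → ℝ → ℝ}, (Continuous fun p : ℝ × ℝ => g p.1 p.2) →
      ∀ t, Continuous fun x => g x t := fun hg t =>
    hg.comp (by fun_prop : Continuous fun x => (x, t))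
  have hswap : ∀ {g : ℝ → ℝ → ℝ}, (Continuous fun p : ℝ × ℝ => g p.1 p.2) →
      Continuous fun p : ℝ × ℝ => g p.2 p.1 := fun hg => hg.comp continuous_swap
  -- the current and its space derivative
  set j := velocityMoment L (fun v => v) f
  set jx := velocityMoment L (fun v => v) fx with hjx
  have hjc : Continuous fun p : ℝ × ℝ => j p.1 p.2 := continuous_velocityMoment L continuous_id hfc
  have hjxc : Continuous fun p : ℝ × ℝ => jx p.1 p.2 :=
    continuous_velocityMoment L continuous_id hfx
  have hjd : ∀ x t, HasDerivAt (fun y => j y t) (jx x t) x :=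
    hasDerivAt_velocityMoment_space L continuous_id hfc hfx hdx
  have hmass : ∀ x, ∀ t ∈ Set.Icc (0 : ℝ) T, velocityMoment L (fun _ => 1) ft x t = -jx x t := by
    intro x t ht
    have h := integral_weight_mul_of_vlasov (w := fun _ => 1) (w' := fun _ => 0)
      (fun v => hdv x v t) (fun v => hasDerivAt_const v 1) continuous_const
      (hslice hfx x t) (hslice hfv x t) (hsupp t ht x) (fun v => hVlasov x v t ht)
    simpa [velocityMoment, hjx] using h
  have henergy : ∀ x, ∀ t ∈ Set.Icc (0 : ℝ) T, velocityMoment L (fun v => v ^ 2 / 2) ft x t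
      = -velocityMoment L (fun v => v * (v ^ 2 / 2)) fx x t - E x t * j x t := by
    intro x t ht
    exact integral_weight_mul_of_vlasov (w := fun v => v ^ 2 / 2) (w' := fun v => v)
      (fun v => hdv x v t)
      (fun v => by simpa using ((hasDerivAt_id v).pow 2).div_const 2) continuous_id
      (hslice hfx x t) (hslice hfv x t) (hsupp t ht x) (fun v => hVlasov x v t ht)
  have hfield : ∀ x, ∀ t ∈ Set.Icc (0 : ℝ) T,
      E x t - E 0 t = x - ∫ y in (0 : ℝ)..x, velocityMoment L (fun _ => 1) f y t := by
    intro x t ht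
    have hR := continuous_velocityMoment L (w := fun _ => 1) continuous_const hfc
    rw [← intervalIntegral.integral_eq_sub_of_hasDerivAt (fun y _ => hdEx y t)
      ((hspace hEx t).intervalIntegrable _ _)]
    have hpt : ∀ y, Ex y t = 1 - velocityMoment L (fun _ => 1) f y t := by
      intro y
      have h1 := hPoisson y t ht
      have h2 := integral_mul_eq_intervalIntegral (fun _ => 1) (hslice hfc y t) (hsupp t ht y)
      rw [hρ] at h1
      simp only [one_mul] at h2
      simp only [velocityMoment, one_mul]
      linarith
    simp_rw [hpt]
    rw [intervalIntegral.integral_sub (by simp) ((hspace hR t).intervalIntegrable _ _)]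
    simp
  -- Ampère's law: the field derivative equals the current up to a function of time
  have hampere : ∀ x, ∀ t ∈ Set.Icc (0 : ℝ) T, Et x t = j x t + (Et 0 t - j 0 t) := by
    intro x t ht
    have h1 : HasDerivAt (fun s => E x s - E 0 s) (Et x t - Et 0 t) t :=
      (hdEt x t).sub (hdEt 0 t)
    have h2 : HasDerivAt
        (fun s => x - ∫ y in (0 : ℝ)..x, velocityMoment L (fun _ => 1) f y s)
        (-∫ y in (0 : ℝ)..x, velocityMoment L (fun _ => 1) ft y t) t :=
      (hasDerivAt_intervalIntegral_of_continuous
        (G := fun s y => velocityMoment L (fun _ => 1) f y s)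
        (G' := fun s y => velocityMoment L (fun _ => 1) ft y s) 0 x
        (hswap (continuous_velocityMoment L continuous_const hfc))
        (hswap (continuous_velocityMoment L continuous_const hft))
        (fun s y => hasDerivAt_velocityMoment_time L continuous_const hfc hft hdt y s) t).const_sub x
    have h3 := UniqueDiffWithinAt.eq_deriv _ (uniqueDiffOn_Icc hT t ht) h1.hasDerivWithinAt
      (h2.hasDerivWithinAt.congr (fun s hs => hfield x s hs) (hfield x t ht))
    simp_rw [fun y => hmass y t ht] at h3
    rw [intervalIntegral.integral_neg, neg_neg,
      intervalIntegral.integral_eq_sub_of_hasDerivAt (fun y _ => hjd y t)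
        ((hspace hjxc t).intervalIntegrable _ _)] at h3
    linarith
  -- the energy with the velocity integral truncated, differentiable for every time
  set H : ℝ → ℝ := fun t => (∫ x in (0 : ℝ)..1, velocityMoment L (fun v => v ^ 2 / 2) f x t)
    + ∫ x in (0 : ℝ)..1, 1 / 2 * E x t ^ 2 with hH
  have h𝓔H : ∀ t ∈ Set.Icc (0 : ℝ) T, 𝓔 t = H t := by
    intro t ht
    rw [h𝓔, hH]
    simp only [velocityMoment, fun x => integral_mul_eq_intervalIntegral (fun v => v ^ 2 / 2)
      (hslice hfc x t) (hsupp t ht x)]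
  have hHd : ∀ t, HasDerivAt H ((∫ x in (0 : ℝ)..1, velocityMoment L (fun v => v ^ 2 / 2) ft x t)
      + ∫ x in (0 : ℝ)..1, E x t * Et x t) t := by
    intro t
    refine HasDerivAt.add ?_ ?_
    · exact hasDerivAt_intervalIntegral_of_continuous
        (G := fun s y => velocityMoment L (fun v => v ^ 2 / 2) f y s)
        (G' := fun s y => velocityMoment L (fun v => v ^ 2 / 2) ft y s) 0 1
        (hswap (continuous_velocityMoment L (by fun_prop) hfc))
        (hswap (continuous_velocityMoment L (by fun_prop) hft))
        (fun s y => hasDerivAt_velocityMoment_time L (by fun_prop) hfc hft hdt y s) t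
    · refine hasDerivAt_intervalIntegral_of_continuous
        (G := fun s y => 1 / 2 * E y s ^ 2) (G' := fun s y => E y s * Et y s) 0 1
        (((hswap hE).pow 2).const_mul _) ((hswap hE).mul (hswap hEt)) (fun s y => ?_) t
      refine (((hdEt y s).pow 2).const_mul (1 / 2)).congr_deriv ?_
      push_cast
      ring
  have hHzero : ∀ t ∈ Set.Icc (0 : ℝ) T, HasDerivAt H 0 t := by
    intro t ht
    refine (hHd t).congr_deriv ?_
    have hflux : ∫ x in (0 : ℝ)..1, velocityMoment L (fun v => v * (v ^ 2 / 2)) fx x t = 0 := by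
      rw [intervalIntegral.integral_eq_sub_of_hasDerivAt
        (fun y _ => hasDerivAt_velocityMoment_space L (by fun_prop) hfc hfx hdx y t)
        ((hspace (continuous_velocityMoment L (by fun_prop) hfx) t).intervalIntegrable _ _)]
      have hper : ∀ v, f 1 v t = f 0 v t := fun v => by simpa using hfper 0 v t
      simp [velocityMoment, hper]
    have hEmean : ∫ x in (0 : ℝ)..1, E x t = 0 := by
      rw [intervalIntegral.integral_eq_sub_of_hasDerivAt (fun y _ => hΦx y t)
        ((hspace hE t).intervalIntegrable _ _)]
      simpa [sub_eq_zero] using hΦper 0 t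
    have hEj : IntervalIntegrable (fun x => E x t * j x t) volume 0 1 :=
      ((hspace hE t).mul (hspace hjc t)).intervalIntegrable _ _
    have hwork : ∀ x, E x t * Et x t = E x t * j x t + E x t * (Et 0 t - j 0 t) := fun x => by
      rw [← mul_add, ← hampere x t ht]
    have hm : IntervalIntegrable
        (fun x => -velocityMoment L (fun v => v * (v ^ 2 / 2)) fx x t) volume 0 1 :=
      (hspace (continuous_velocityMoment L (by fun_prop) hfx) t).neg.intervalIntegrable _ _
    have hEc : IntervalIntegrable (fun x => E x t * (Et 0 t - j 0 t)) volume 0 1 :=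
      ((hspace hE t).mul continuous_const).intervalIntegrable _ _
    simp_rw [fun x => henergy x t ht]
    rw [intervalIntegral.integral_congr fun x _ => hwork x]
    rw [intervalIntegral.integral_sub hm hEj,
      intervalIntegral.integral_add hEj hEc,
      intervalIntegral.integral_neg, intervalIntegral.integral_mul_const, hflux, hEmean]
    ring
  intro t ht
  rw [h𝓔H t ht, h𝓔H 0 ⟨le_rfl, hT.le⟩]
  exact constant_of_has_deriv_right_zero
    (fun s hs => (hHzero s hs).continuousAt.continuousWithinAt)
    (fun s hs => (hHzero s ⟨hs.1, hs.2.le⟩).hasDerivWithinAt) t ht
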